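/- arXiv:1306.3773 — 6 statements merged into one kernel-verified Lean document; each statement's English description precedes it below -/
import Mathlib

section
/- Let A be a group and let (B, b, s_b), (C, c, s_c), (D, d, s_d) be points over A in the category of groups. Let φ : B →* C and γ : C →* D be morphisms of points over A. Assume γ is surjective, φ is injective, and the range of φ equals the preimage under γ of the range of s_d. Then: φ maps ker b into ker c and γ maps ker c into ker d; the restriction of φ to ker b is injective; the restriction of γ maps ker c onto ker d; and for y ∈ ker c one has γ y = 1 if and only if y lies in the image of ker b under φ. -/
/-- Kernel functors preserve short exact sequences, in the category of groups: a short exact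
sequence of points over `A` restricts to a short exact sequence of kernels. -/
theorem ker_restriction_of_ses_of_points
    {A B C D : Type*} [Group A] [Group B] [Group C] [Group D]
    (b : B →* A) (sb : A →* B) (hb : b.comp sb = MonoidHom.id A)
    (c : C →* A) (sc : A →* C) (hc : c.comp sc = MonoidHom.id A)
    (d : D →* A) (sd : A →* D) (hd : d.comp sd = MonoidHom.id A)
    (φ : B →* C) (hφ1 : c.comp φ = b) (hφ2 : φ.comp sb = sc)
    (γ : C →* D) (hγ1 : d.comp γ = c) (hγ2 : γ.comp sc = sd)
    (hγsurj : Function.Surjective γ) (hφinj : Function.Injective φ)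
    (hexact : φ.range = Subgroup.comap γ sd.range) :
    (∀ x ∈ b.ker, φ x ∈ c.ker) ∧ (∀ y ∈ c.ker, γ y ∈ d.ker) ∧
      Set.InjOn φ (b.ker : Set B) ∧ Set.SurjOn γ (c.ker : Set C) (d.ker : Set D) ∧
      ∀ y ∈ c.ker, (γ y = 1 ↔ ∃ x ∈ b.ker, φ x = y) := by
  subst hφ1 hγ1
  refine ⟨fun x hx => hx, fun y hy => hy, hφinj.injOn, fun z hz => ?_, fun y hy => ⟨fun h => ?_, ?_⟩⟩
  · obtain ⟨y, rfl⟩ := hγsurj z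
    exact ⟨y, hz, rfl⟩
  · have hy_range : y ∈ φ.range := by
      rw [hexact, Subgroup.mem_comap, h]
      exact one_mem _
    obtain ⟨x, rfl⟩ := hy_range
    exact ⟨x, hy, rfl⟩
  · rintro ⟨x, hx, rfl⟩
    have hφx : φ x ∈ Subgroup.comap γ sd.range := hexact ▸ ⟨x, rfl⟩
    obtain ⟨a, ha⟩ := hφx
    have ha_one : a = 1 := by
      calc a = d (sd a) := (DFunLike.congr_fun hd a).symm
        _ = d (γ (φ x)) := by rw [ha]
        _ = 1 := hx
    rw [← ha, ha_one, map_one]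
end

section
/- Let A be a group and let (B, b, s_b), (C, c, s_c), (D, d, s_d) be points over A in the category of groups. Let φ : B →* C and γ : C →* D be morphisms of points over A. Assume that the restriction of φ to ker b is injective, that the restriction of γ maps ker c onto ker d, and that for y ∈ ker c one has γ y = 1 if and only if y lies in the image of ker b under φ. Then γ is surjective, φ is injective, and the range of φ equals the preimage under γ of the range of s_d. -/
/-- Kernel functors reflect short exact sequences, in the category of groups: a pair of
morphisms of points over `A` whose restriction to kernels is a short exact sequence of
groups is itself a short exact sequence of points. -/
theorem ses_of_points_of_ker_restriction
    {A B C D : Type*} [Group A] [Group B] [Group C] [Group D]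
    (b : B →* A) (sb : A →* B) (hb : b.comp sb = MonoidHom.id A)
    (c : C →* A) (sc : A →* C) (hc : c.comp sc = MonoidHom.id A)
    (d : D →* A) (sd : A →* D) (hd : d.comp sd = MonoidHom.id A)
    (φ : B →* C) (hφ1 : c.comp φ = b) (hφ2 : φ.comp sb = sc)
    (γ : C →* D) (hγ1 : d.comp γ = c) (hγ2 : γ.comp sc = sd)
    (hinj : Set.InjOn φ (b.ker : Set B))
    (hsurj : Set.SurjOn γ (c.ker : Set C) (d.ker : Set D))
    (hexact : ∀ y ∈ c.ker, (γ y = 1 ↔ ∃ x ∈ b.ker, φ x = y)) :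
    Function.Surjective γ ∧ Function.Injective φ ∧
      φ.range = Subgroup.comap γ sd.range := by
  have hb' (a : A) : b (sb a) = a := DFunLike.congr_fun hb a
  have hc' (a : A) : c (sc a) = a := DFunLike.congr_fun hc a
  have hd' (a : A) : d (sd a) = a := DFunLike.congr_fun hd a
  have hcφ (x : B) : c (φ x) = b x := DFunLike.congr_fun hφ1 x
  have hφs (a : A) : φ (sb a) = sc a := DFunLike.congr_fun hφ2 a
  have hdγ (y : C) : d (γ y) = c y := DFunLike.congr_fun hγ1 y
  have hγs (a : A) : γ (sc a) = sd a := DFunLike.congr_fun hγ2 a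
  refine ⟨fun z => ?_, ?_, ?_⟩
  · obtain ⟨y, -, hy⟩ := hsurj (show z * (sd (d z))⁻¹ ∈ (d.ker : Set D) by
      simp [MonoidHom.mem_ker, hd'])
    exact ⟨y * sc (d z), by simp [hy, hγs]⟩
  · refine (injective_iff_map_eq_one φ).2 fun x hx => ?_
    have hbx : x ∈ b.ker := by rw [MonoidHom.mem_ker, ← hcφ, hx, map_one]
    exact hinj hbx b.ker.one_mem (hx.trans (map_one φ).symm)
  · ext y
    constructor
    · rintro ⟨x, rfl⟩
      have hker : x * (sb (b x))⁻¹ ∈ b.ker := by simp [MonoidHom.mem_ker, hb']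
      have hγφ : γ (φ (x * (sb (b x))⁻¹)) = 1 :=
        (hexact _ (by rwa [MonoidHom.mem_ker, hcφ])).2 ⟨_, hker, rfl⟩
      simp only [map_mul, map_inv, hφs, hγs] at hγφ
      exact ⟨b x, (mul_inv_eq_one.1 hγφ).symm⟩
    · rintro ⟨a, ha⟩
      have hcy : c y = a := by rw [← hdγ, ← ha, hd']
      obtain ⟨x, -, hx⟩ := (hexact (y * (sc a)⁻¹)
        (by simp [MonoidHom.mem_ker, hcy, hc'])).1 (by simp [hγs, ha])
      exact ⟨x * sb a, by simp [hx, hφs]⟩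
end

section
/- Let A be a group, let (B, b, s_b) and (C, c, s_c) be points over A in the category of groups, and let φ : B →* C be a morphism of points over A. Then the following are equivalent: (i) the restriction of φ to ker b is injective and its image is a normal subgroup of C; (ii) φ is injective and there exist a point (D, d, s_d) over A and a morphism of points γ : C →* D over A such that the range of φ equals the preimage under γ of the range of s_d. -/
universe u

/-- Characterization of kernels in the fiber of points over `A`, in the category of groups:
a morphism of points `φ` is a kernel in `Pt_A` (i.e. `φ` is injective and its range is the
`γ`-preimage of the range of a section, for some morphism of points `γ`) if and only if its
restriction to kernels is injective with normal image. -/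
theorem kernel_in_points_iff_ker_restriction_kernel
    {A B C : Type u} [Group A] [Group B] [Group C]
    (b : B →* A) (sb : A →* B) (hb : b.comp sb = MonoidHom.id A)
    (c : C →* A) (sc : A →* C) (hc : c.comp sc = MonoidHom.id A)
    (φ : B →* C) (hφ1 : c.comp φ = b) (hφ2 : φ.comp sb = sc) :
    (Set.InjOn φ (b.ker : Set B) ∧ (Subgroup.map φ b.ker).Normal) ↔
      (Function.Injective φ ∧
        ∃ (D : Type u) (_ : Group D) (d : D →* A) (sd : A →* D),
          d.comp sd = MonoidHom.id A ∧
          ∃ γ : C →* D, d.comp γ = c ∧ γ.comp sc = sd ∧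
            φ.range = Subgroup.comap γ sd.range) := by
  have hb' (a : A) : b (sb a) = a := DFunLike.congr_fun hb a
  have hc' (a : A) : c (sc a) = a := DFunLike.congr_fun hc a
  have hφb (y : B) : c (φ y) = b y := DFunLike.congr_fun hφ1 y
  have hφs (a : A) : φ (sb a) = sc a := DFunLike.congr_fun hφ2 a
  constructor
  · rintro ⟨hinj, hN⟩
    refine ⟨(injective_iff_map_eq_one φ).2 fun y hy => ?_, ?_⟩
    · have hyb : b y = 1 := by rw [← hφb, hy, map_one]
      exact hinj hyb (one_mem b.ker) (hy.trans (map_one φ).symm)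
    · have hNc : Subgroup.map φ b.ker ≤ c.ker := by
        rintro _ ⟨y, hy, rfl⟩
        exact (hφb y).trans hy
      refine ⟨C ⧸ Subgroup.map φ b.ker, inferInstance, QuotientGroup.lift _ c hNc,
        (QuotientGroup.mk' _).comp sc, MonoidHom.ext hc', QuotientGroup.mk' _,
        MonoidHom.ext fun _ => rfl, rfl, ?_⟩
      ext x
      constructor
      · rintro ⟨y, rfl⟩
        refine ⟨b y, QuotientGroup.eq.2 ⟨(sb (b y))⁻¹ * y, ?_, ?_⟩⟩
        · simp [MonoidHom.mem_ker, hb']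
        · simp [hφs]
      · rintro ⟨a, ha⟩
        obtain ⟨k, -, hk⟩ := QuotientGroup.eq.1 ha
        exact ⟨sb a * k, by rw [map_mul, hφs, hk, mul_inv_cancel_left]⟩
  · rintro ⟨hinj, D, _, d, sd, hd, γ, hγ1, hγ2, hrange⟩
    refine ⟨hinj.injOn, ?_⟩
    have hd' (a : A) : d (sd a) = a := DFunLike.congr_fun hd a
    have hγc (x : C) : d (γ x) = c x := DFunLike.congr_fun hγ1 x
    have hker : Subgroup.map φ b.ker = γ.ker := by
      ext x
      constructor
      · rintro ⟨y, hy, rfl⟩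
        have hmem : φ y ∈ Subgroup.comap γ sd.range := hrange ▸ ⟨y, rfl⟩
        obtain ⟨a, ha⟩ := hmem
        have hya : a = 1 := by
          rw [← hd' a, ha, hγc, hφb]
          exact hy
        rw [MonoidHom.mem_ker, ← ha, hya, map_one]
      · intro hx
        rw [MonoidHom.mem_ker] at hx
        have hmem : x ∈ φ.range := by
          rw [hrange, Subgroup.mem_comap, hx]
          exact one_mem _
        obtain ⟨y, rfl⟩ := hmem
        exact ⟨y, by simp [MonoidHom.mem_ker, ← hφb, ← hγc, hx], rfl⟩
    rw [hker]
    infer_instance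
end

section
/- Let A, C, Q be groups, c : C →* A a group homomorphism with a section s : A →* C (c ∘ s = id), and q : A →* Q a surjective group homomorphism with kernel K. Assume that every element of the image of K under s commutes with every element of ker c. Then: (1) the subgroup N := K.map s of C is normal in C; (2) the composite q ∘ c kills N, so it induces a homomorphism d : C ⧸ N →* Q; (3) d is surjective and admits a section σ : Q →* C ⧸ N with d ∘ σ = id, determined by σ (q a) = QuotientGroup.mk (s a) for a ∈ A; and (4) the kernel of d equals the image of ker c under the projection C → C ⧸ N. -/
/-- An element of a split extension differs from its retraction by an element of the kernel. -/
theorem mul_section_inv_mem_ker {A C : Type*} [Group A] [Group C]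
    {c : C →* A} {s : A →* C} (hs : c.comp s = MonoidHom.id A) (x : C) :
    x * (s (c x))⁻¹ ∈ c.ker := by
  have h : c (s (c x)) = c x := DFunLike.congr_fun hs (c x)
  simp [MonoidHom.mem_ker, h]

/-- The image under a section of a normal subgroup acting trivially on the kernel is normal. -/
theorem normal_map_section {A C : Type*} [Group A] [Group C]
    {c : C →* A} {s : A →* C} (hs : c.comp s = MonoidHom.id A) (K : Subgroup A) [K.Normal]
    (hcomm : ∀ x ∈ K.map s, ∀ y ∈ c.ker, Commute x y) : (K.map s).Normal := by
  refine ⟨?_⟩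
  rintro _ ⟨k, hk, rfl⟩ g
  have hmem : s (c g * k * (c g)⁻¹) ∈ K.map s :=
    Subgroup.mem_map_of_mem s (Subgroup.Normal.conj_mem inferInstance k hk (c g))
  have h := (hcomm _ hmem _ (mul_section_inv_mem_ker hs g)).symm.mul_inv_cancel
  have hconj : g * s k * g⁻¹ = s (c g * k * (c g)⁻¹) := by
    rw [← h]
    simp only [map_mul, map_inv]
    group
  rwa [hconj]

/-- Push-forward of points along a quotient of groups: if `c : C →* A` is a point over `A`
with section `s`, `q : A →* Q` is surjective with kernel `K`, and the image `s(K)` commutes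
elementwise with `ker c` (the induced action of `K` on `ker c` is trivial), then
`N = s(K)` is normal in `C`, `q ∘ c` kills `N` and induces a split epimorphism
`d : C ⧸ N →* Q` with section `σ` determined by `σ (q a) = ⟦s a⟧`, whose kernel is the
image of `ker c` in `C ⧸ N`. -/
theorem point_descends_along_quotient
    {A C Q : Type*} [Group A] [Group C] [Group Q]
    (c : C →* A) (s : A →* C) (hs : c.comp s = MonoidHom.id A)
    (q : A →* Q) (hq : Function.Surjective q)
    (hcomm : ∀ x ∈ Subgroup.map s q.ker, ∀ y ∈ c.ker, Commute x y) :
    ∃ hN : (Subgroup.map s q.ker).Normal,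
      (∀ x ∈ Subgroup.map s q.ker, q (c x) = 1) ∧
      haveI := hN
      ∃ d : C ⧸ Subgroup.map s q.ker →* Q,
        (∀ x : C, d (QuotientGroup.mk x) = q (c x)) ∧
        Function.Surjective d ∧
        (∃ σ : Q →* C ⧸ Subgroup.map s q.ker,
          d.comp σ = MonoidHom.id Q ∧
          ∀ a : A, σ (q a) = QuotientGroup.mk (s a)) ∧
        d.ker = Subgroup.map (QuotientGroup.mk' (Subgroup.map s q.ker)) c.ker := by
  have hcs (a : A) : c (s a) = a := DFunLike.congr_fun hs a
  have hN : (Subgroup.map s q.ker).Normal := normal_map_section hs q.ker hcomm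
  have hkill : ∀ x ∈ Subgroup.map s q.ker, q (c x) = 1 := by
    rintro _ ⟨k, hk, rfl⟩
    rw [hcs]
    exact hk
  have hle : q.ker ≤ ((QuotientGroup.mk' (Subgroup.map s q.ker)).comp s).ker := fun k hk =>
    (QuotientGroup.eq_one_iff (s k)).2 (Subgroup.mem_map_of_mem s hk)
  have hσ (a : A) : q.liftOfSurjective hq ⟨_, hle⟩ (q a) = QuotientGroup.mk (s a) :=
    MonoidHom.liftOfRightInverse_comp_apply q _ (Function.rightInverse_surjInv hq) ⟨_, hle⟩ a
  refine ⟨hN, hkill, QuotientGroup.lift _ (q.comp c) hkill, fun _ => rfl, ?_,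
    ⟨q.liftOfSurjective hq ⟨_, hle⟩, ?_, hσ⟩, ?_⟩
  · intro y
    obtain ⟨a, rfl⟩ := hq y
    exact ⟨QuotientGroup.mk (s a), congrArg q (hcs a)⟩
  · ext y
    obtain ⟨a, rfl⟩ := hq y
    rw [MonoidHom.comp_apply, hσ]
    exact congrArg q (hcs a)
  · apply le_antisymm
    · intro z hz
      obtain ⟨x, rfl⟩ := QuotientGroup.mk_surjective z
      have hx : c x ∈ q.ker := hz
      refine ⟨x * (s (c x))⁻¹, mul_section_inv_mem_ker hs x, ?_⟩
      exact QuotientGroup.mk_mul_of_mem x (inv_mem (Subgroup.mem_map_of_mem s hx))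
    · rintro _ ⟨x, hx, rfl⟩
      have hx' : c x = 1 := hx
      change q (c x) = 1
      rw [hx', map_one]
end

section
/- Let R be a commutative ring and let A and Y be Lie algebras over R. Let ρ : A →ₗ⁅R⁆ LieDerivation R Y Y be a morphism of Lie algebras from A to the Lie algebra of derivations of Y (an action of A on Y by derivations), and let I be a Lie ideal of Y such that ρ a x ∈ I for every a ∈ A and x ∈ I. Then there exists a morphism of Lie algebras ρ' : A →ₗ⁅R⁆ LieDerivation R (Y ⧸ I) (Y ⧸ I) into the derivations of the quotient Lie algebra Y ⧸ I such that for all a ∈ A and y ∈ Y, ρ' a applied to the class of y equals the class of ρ a y. -/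
namespace LieDerivation

variable {R Y : Type*} [CommRing R] [LieRing Y] [LieAlgebra R Y]

/-- The derivation of `Y ⧸ I` induced by a derivation of `Y` preserving the Lie ideal `I`. -/
def quotientMap (I : LieIdeal R Y) (D : LieDerivation R Y Y) (hD : ∀ x ∈ I, D x ∈ I) :
    LieDerivation R (Y ⧸ I) (Y ⧸ I) where
  toLinearMap := Submodule.mapQ I.toSubmodule I.toSubmodule D.toLinearMap hD
  leibniz' a b := by
    obtain ⟨x, rfl⟩ := LieSubmodule.Quotient.surjective_mk' I a
    obtain ⟨y, rfl⟩ := LieSubmodule.Quotient.surjective_mk' I b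
    exact congrArg (LieSubmodule.Quotient.mk (N := I)) (D.apply_lie_eq_sub x y)

theorem quotientMap_mk (I : LieIdeal R Y) (D : LieDerivation R Y Y) (hD : ∀ x ∈ I, D x ∈ I)
    (y : Y) :
    quotientMap I D hD (LieSubmodule.Quotient.mk (N := I) y) =
      LieSubmodule.Quotient.mk (N := I) (D y) :=
  rfl

/-- Derivations of a quotient Lie algebra agree if they agree on classes. -/
theorem quotient_ext {I : LieIdeal R Y} {D₁ D₂ : LieDerivation R (Y ⧸ I) (Y ⧸ I)}
    (h : ∀ y : Y, D₁ (LieSubmodule.Quotient.mk (N := I) y) =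
      D₂ (LieSubmodule.Quotient.mk (N := I) y)) : D₁ = D₂ := by
  ext z
  obtain ⟨y, rfl⟩ := LieSubmodule.Quotient.surjective_mk' I z
  exact h y

end LieDerivation

/-- Property (KC) in the category of Lie algebras: an action of a Lie algebra `A` on `Y` by
derivations that restricts to a Lie ideal `I` of `Y` passes to the quotient `Y ⧸ I`. -/
theorem lie_action_passes_to_quotient
    {R A Y : Type*} [CommRing R]
    [LieRing A] [LieAlgebra R A] [LieRing Y] [LieAlgebra R Y]
    (ρ : A →ₗ⁅R⁆ LieDerivation R Y Y) (I : LieIdeal R Y)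
    (hres : ∀ (a : A), ∀ x ∈ I, ρ a x ∈ I) :
    ∃ ρ' : A →ₗ⁅R⁆ LieDerivation R (Y ⧸ I) (Y ⧸ I),
      ∀ (a : A) (y : Y),
        ρ' a (LieSubmodule.Quotient.mk (N := I) y) =
          LieSubmodule.Quotient.mk (N := I) (ρ a y) := by
  refine ⟨{ toFun := fun a => LieDerivation.quotientMap I (ρ a) (hres a)
            map_add' := fun a b => LieDerivation.quotient_ext fun y => ?_
            map_smul' := fun r a => LieDerivation.quotient_ext fun y => ?_
            map_lie' := fun {a b} => LieDerivation.quotient_ext fun y => ?_ },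
    fun a y => LieDerivation.quotientMap_mk I (ρ a) (hres a) y⟩
  · rw [LieDerivation.quotientMap_mk, map_add]
    rfl
  · rw [LieDerivation.quotientMap_mk, map_smul]
    rfl
  · rw [LieDerivation.quotientMap_mk, LieHom.map_lie, LieDerivation.lie_apply,
      LieDerivation.lie_apply]
    rfl
end

section
/- Let 𝒞 be a category with a zero object, zero morphisms, and finite limits. Let c : C ⟶ A with section s_c : A ⟶ C (s_c ≫ c = 𝟙 A), d : D ⟶ A with section s_d : A ⟶ D (s_d ≫ d = 𝟙 A), and let γ : C ⟶ D satisfy γ ≫ d = c and s_c ≫ γ = s_d. Let g : kernel c ⟶ kernel d be the morphism induced by γ between the kernels, and let B be the pullback of γ : C ⟶ D and s_d : A ⟶ D, with second projection b : B ⟶ A. Then the kernel of b is isomorphic to the kernel of g. -/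
open CategoryTheory CategoryTheory.Limits

universe v u

/-- The kernel of the second projection of a pullback of `f` is the kernel of `f`. -/
noncomputable def kernelPullbackSndIso {𝒞 : Type u} [Category.{v} 𝒞] [HasZeroMorphisms 𝒞]
    {X Y Z : 𝒞} (f : X ⟶ Z) (s : Y ⟶ Z) [HasPullback f s] [HasKernel f]
    [HasKernel (pullback.snd f s)] : kernel (pullback.snd f s) ≅ kernel f where
  hom := kernel.lift f (kernel.ι (pullback.snd f s) ≫ pullback.fst f s) (by
    rw [Category.assoc, pullback.condition, kernel.condition_assoc, zero_comp])
  inv := kernel.lift (pullback.snd f s) (pullback.lift (kernel.ι f) 0 (by simp)) (pullback.lift_snd _ _ _)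
  hom_inv_id := by
    ext <;> simp [pullback.lift_fst, pullback.lift_snd]
  inv_hom_id := by
    ext; simp [pullback.lift_fst]

/-- If `γ ≫ d = c`, the kernel of the morphism `kernel c ⟶ kernel d` induced by `γ` is the
kernel of `γ`. -/
noncomputable def kernelRestrictionIso {𝒞 : Type u} [Category.{v} 𝒞] [HasZeroMorphisms 𝒞]
    [HasKernels 𝒞] {A C D : 𝒞} {c : C ⟶ A} {d : D ⟶ A} {γ : C ⟶ D} (hγd : γ ≫ d = c)
    {g : kernel c ⟶ kernel d} (hg : g ≫ kernel.ι d = kernel.ι c ≫ γ) :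
    kernel g ≅ kernel γ where
  hom := kernel.lift γ (kernel.ι g ≫ kernel.ι c) (by
    rw [Category.assoc, ← hg, kernel.condition_assoc, zero_comp])
  inv := kernel.lift g (kernel.lift c (kernel.ι γ) (by
      rw [← hγd, kernel.condition_assoc, zero_comp])) (by
    ext
    simp [hg])
  hom_inv_id := by
    ext; simp
  inv_hom_id := by
    ext; simp

/-- In a pointed finitely complete category, for a morphism of points `γ` over `A`, the kernel
of the point obtained by pulling back `γ` along the section `s_d` is isomorphic to the kernel
of the induced morphism `g : kernel c ⟶ kernel d` between the kernels of the two points. -/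
theorem kernel_pullback_snd_iso_kernel_restriction
    {𝒞 : Type u} [Category.{v} 𝒞] [HasZeroObject 𝒞] [HasZeroMorphisms 𝒞] [HasFiniteLimits 𝒞]
    {A C D : 𝒞} (c : C ⟶ A) (sc : A ⟶ C) (hc : sc ≫ c = 𝟙 A)
    (d : D ⟶ A) (sd : A ⟶ D) (hd : sd ≫ d = 𝟙 A)
    (γ : C ⟶ D) (hγd : γ ≫ d = c) (hγs : sc ≫ γ = sd)
    (g : kernel c ⟶ kernel d) (hg : g ≫ kernel.ι d = kernel.ι c ≫ γ) :
    Nonempty (kernel (pullback.snd γ sd) ≅ kernel g) := by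
  exact ⟨kernelPullbackSndIso γ sd ≪≫ (kernelRestrictionIso hγd hg).symm⟩
end
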